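/- Suppose the approximate strategy α̂ ∈ (Ĝ_L)^N and the approximate control b̂ ∈ (ℬ̂_M)^N produced by the global scheme satisfy the η_2-suboptimality condition E[ J̃_0(X, α̂[b̂], b̂) ] ≥ sup_{b ∈ ℬ̂^N} E[ J̃_0(X, α̂[b], b) ] − η_2, and let b* ∈ (ℬ_M)^N be an ε_2-optimal Lipschitz feedback control for α̂, i.e., E[V_0(X)] ≤ E[ J̃_0(X, α̂[b*], b*) ] + ε_2. Define V̂_0(x) = J̃_0(x, α̂[b̂], b̂). Then there exists a constant C_{L,M} ≥ 0, depending only on L, M and on the data, such that E[ V̂_0(X) ] − E[ V_0(X) ] ≥ − C_{L,M} max_{0≤k≤N−1} d_{L^∞(Ω_N)}(b*_k, ℬ̂_M) − η_2 − ε_2, where d_{L^∞(Ω_N)}(b*, ℬ̂_M) = inf_{b ∈ ℬ̂_M} ‖b − b*‖_{L^∞(Ω_N)} and Ω_N = { X_{k,x}^{a,b} : x ∈ Ω_0, 0 ≤ k ≤ N, (a,b) ∈ A^N × B^N } is the discrete reachable set from the support Ω_0 of X. -/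

import Mathlib

open MeasureTheory Set

noncomputable section

abbrev Euc (n : ℕ) : Type := EuclideanSpace ℝ (Fin n)

/-- periodic extension of a `Fin N`-tuple to an `ℕ`-indexed family -/
def extp {γ : Sort*} {N : ℕ} (hN : 0 < N) (c : Fin N → γ) : ℕ → γ :=
  fun k => c ⟨k % N, Nat.mod_lt k hN⟩

/-- discrete trajectory driven by open-loop controls -/
def oTraj {d nA nB : ℕ} (F : Euc d → Euc nA → Euc nB → Euc d) (x : Euc d)
    (a : ℕ → Euc nA) (b : ℕ → Euc nB) : ℕ → Euc d
  | 0 => x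
  | k + 1 => F (oTraj F x a b k) (a k) (b k)

/-- payoff `(max_{0 ≤ k ≤ N-1} g(x_k)) ⊔ φ(x_N)` -/
def payoff {d : ℕ} (g φ : Euc d → ℝ) (N : ℕ) (xs : ℕ → Euc d) : ℝ :=
  (⨆ k : Fin N, g (xs k)) ⊔ φ (xs N)

def J0 {d nA nB : ℕ} (F : Euc d → Euc nA → Euc nB → Euc d) (g φ : Euc d → ℝ)
    {N : ℕ} (hN : 0 < N) (x : Euc d) (a : Fin N → Euc nA) (b : Fin N → Euc nB) : ℝ :=
  payoff g φ N (oTraj F x (extp hN a) (extp hN b))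

/-- discrete non-anticipative strategies -/
def SN {nA nB : ℕ} (A : Set (Euc nA)) (B : Set (Euc nB)) (N : ℕ) : Type :=
  {α : (Fin N → B) → Fin N → A //
    Measurable α ∧ ∀ (k : Fin N) (b b' : Fin N → B), (∀ j ≤ k, b j = b' j) → α b k = α b' k}

/-- Elliott–Kalton semi-discrete value -/
def V0 {d nA nB : ℕ} (A : Set (Euc nA)) (B : Set (Euc nB))
    (F : Euc d → Euc nA → Euc nB → Euc d) (g φ : Euc d → ℝ) {N : ℕ} (hN : 0 < N)
    (x : Euc d) : ℝ :=
  ⨅ α : SN A B N, ⨆ b : Fin N → B,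
    J0 F g φ hN x (fun i => (α.1 b i : Euc nA)) (fun i => (b i : Euc nB))

/-- nested alternating sup-inf value -/
def altVal {α β : Type*} : (n : ℕ) → ((Fin n → α) → (Fin n → β) → ℝ) → ℝ
  | 0, J => J (fun i => i.elim0) (fun i => i.elim0)
  | n + 1, J => ⨆ b0 : β, ⨅ a0 : α, altVal n (fun a b => J (Fin.cons a0 a) (Fin.cons b0 b))

/-- Fleming alternating value -/
def flemingV0 {d nA nB : ℕ} (A : Set (Euc nA)) (B : Set (Euc nB))
    (F : Euc d → Euc nA → Euc nB → Euc d) (g φ : Euc d → ℝ) {N : ℕ} (hN : 0 < N)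
    (x : Euc d) : ℝ :=
  altVal N (fun (a : Fin N → A) (b : Fin N → B) =>
    J0 F g φ hN x (fun i => (a i : Euc nA)) (fun i => (b i : Euc nB)))

/-- feedback trajectory -/
def fbTraj {d nA nB : ℕ} {A : Set (Euc nA)} {B : Set (Euc nB)}
    (F : Euc d → Euc nA → Euc nB → Euc d) (x : Euc d)
    (α : ℕ → Euc d × B → A) (b : ℕ → Euc d → B) : ℕ → Euc d
  | 0 => x
  | k + 1 =>
    F (fbTraj F x α b k)
      (α k (fbTraj F x α b k, b k (fbTraj F x α b k)) : Euc nA)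
      (b k (fbTraj F x α b k) : Euc nB)

/-- set of measurable feedback strategies `ℝ^d × B → A` -/
def Gm (d : ℕ) {nA nB : ℕ} (A : Set (Euc nA)) (B : Set (Euc nB)) : Type :=
  {α : Euc d × B → A // Measurable α}

/-- set of measurable feedback controls `ℝ^d → B` -/
def Bm (d : ℕ) {nB : ℕ} (B : Set (Euc nB)) : Type :=
  {b : Euc d → B // Measurable b}

def Am (d : ℕ) {nA : ℕ} (A : Set (Euc nA)) : Type :=
  {a : Euc d → A // Measurable a}

/-- payoff `J̃0` for a feedback strategy against an open-loop control -/
def tJ0 {d nA nB : ℕ} {A : Set (Euc nA)} {B : Set (Euc nB)}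
    (F : Euc d → Euc nA → Euc nB → Euc d) (g φ : Euc d → ℝ) {N : ℕ} (hN : 0 < N)
    (x : Euc d) (α : Fin N → Euc d × B → A) (b : Fin N → B) : ℝ :=
  payoff g φ N (fbTraj F x (extp hN α) (fun k _ => extp hN b k))

/-- payoff `J̃0` for a feedback strategy against a feedback control -/
def tJ0fb {d nA nB : ℕ} {A : Set (Euc nA)} {B : Set (Euc nB)}
    (F : Euc d → Euc nA → Euc nB → Euc d) (g φ : Euc d → ℝ) {N : ℕ} (hN : 0 < N)
    (x : Euc d) (α : Fin N → Euc d × B → A) (b : Fin N → Euc d → B) : ℝ :=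
  payoff g φ N (fbTraj F x (extp hN α) (extp hN b))

/-- feedback value `Ṽ0` -/
def tV0 {d nA nB : ℕ} (A : Set (Euc nA)) (B : Set (Euc nB))
    (F : Euc d → Euc nA → Euc nB → Euc d) (g φ : Euc d → ℝ) {N : ℕ} (hN : 0 < N)
    (x : Euc d) : ℝ :=
  ⨅ α : Fin N → Gm d A B, ⨆ b : Fin N → B,
    tJ0 F g φ hN x (fun k => (α k).1) b

/-- intermediate value functions (backward DPP); `Vk m` is the value with `m` steps to go. -/
def Vdpp {d nA nB : ℕ} (A : Set (Euc nA)) (B : Set (Euc nB))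
    (F : Euc d → Euc nA → Euc nB → Euc d) (g φ : Euc d → ℝ) : ℕ → Euc d → ℝ
  | 0, x => φ x
  | m + 1, x => ⨆ b : B, ⨅ a : A, g x ⊔ Vdpp A B F g φ m (F x (a : Euc nA) (b : Euc nB))


/-- Euler scheme map -/
def euler {d nA nB : ℕ} (f : Euc d → Euc nA → Euc nB → Euc d) (τ : ℝ) :
    Euc d → Euc nA → Euc nB → Euc d :=
  fun z a b => z + τ • f z a b

/-- discrete reachable set `Ω_N` from `Ω₀` -/
def reachSet {d nA nB : ℕ} (A : Set (Euc nA)) (B : Set (Euc nB))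
    (f : Euc d → Euc nA → Euc nB → Euc d) (τ : ℝ) (N : ℕ) (Ω₀ : Set (Euc d)) :
    Set (Euc d) :=
  {z | ∃ x ∈ Ω₀, ∃ k ≤ N, ∃ a : ℕ → A, ∃ b : ℕ → B,
    z = oTraj (euler f τ) x (fun j => (a j : Euc nA)) (fun j => (b j : Euc nB)) k}

/-- Feedback trajectories are open-loop trajectories for the controls they generate. -/
lemma fbTraj_eq_oTraj {d nA nB : ℕ} {A : Set (Euc nA)} {B : Set (Euc nB)}
    (F : Euc d → Euc nA → Euc nB → Euc d) (x : Euc d)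
    (α : ℕ → Euc d × B → A) (b : ℕ → Euc d → B) (k : ℕ) :
    fbTraj F x α b k = oTraj F x
      (fun j => (α j (fbTraj F x α b j, b j (fbTraj F x α b j)) : Euc nA))
      (fun j => (b j (fbTraj F x α b j) : Euc nB)) k := by
  induction k with
  | zero => rfl
  | succ k ih =>
    simp only [fbTraj, oTraj]
    rw [← ih]

lemma fbTraj_mem_reachSet {d nA nB : ℕ} {A : Set (Euc nA)} {B : Set (Euc nB)}
    (f : Euc d → Euc nA → Euc nB → Euc d) (τ : ℝ) {N : ℕ} {Ω₀ : Set (Euc d)} {x : Euc d}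
    (hx : x ∈ Ω₀) (α : ℕ → Euc d × B → A) (b : ℕ → Euc d → B) {k : ℕ} (hk : k ≤ N) :
    fbTraj (euler f τ) x α b k ∈ reachSet A B f τ N Ω₀ :=
  ⟨x, hx, k, hk, _, _, fbTraj_eq_oTraj _ _ _ _ _⟩

/-- Joint Lipschitz estimate for a map on states and admissible controls. -/
def LipOn {d nA nB : ℕ} (A : Set (Euc nA)) (B : Set (Euc nB))
    (F : Euc d → Euc nA → Euc nB → Euc d) (L1 L2 L3 : ℝ) : Prop :=
  ∀ x x' : Euc d, ∀ a a' : Euc nA, a ∈ A → a' ∈ A → ∀ b b' : Euc nB, b ∈ B → b' ∈ B →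
    ‖F x a b - F x' a' b'‖ ≤ L1 * ‖x - x'‖ + L2 * ‖a - a'‖ + L3 * ‖b - b'‖

lemma LipOn.euler {d nA nB : ℕ} {A : Set (Euc nA)} {B : Set (Euc nB)}
    {f : Euc d → Euc nA → Euc nB → Euc d} {L1 L2 L3 : ℝ} (hf : LipOn A B f L1 L2 L3)
    {τ : ℝ} (hτ : 0 ≤ τ) :
    LipOn A B (euler f τ) (1 + τ * L1) (τ * L2) (τ * L3) := by
  intro x x' a a' ha ha' b b' hb hb'
  have h1 : _root_.euler f τ x a b - _root_.euler f τ x' a' b'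
      = (x - x') + τ • (f x a b - f x' a' b') := by
    simp only [_root_.euler, smul_sub]; abel
  rw [h1]
  refine (norm_add_le _ _).trans ?_
  rw [norm_smul, Real.norm_of_nonneg hτ]
  nlinarith [mul_le_mul_of_nonneg_left (hf x x' a a' ha ha' b b' hb hb') hτ]

lemma LipOn.continuous {d nA nB : ℕ} {A : Set (Euc nA)} {B : Set (Euc nB)}
    {F : Euc d → Euc nA → Euc nB → Euc d} {L1 L2 L3 : ℝ} (hF : LipOn A B F L1 L2 L3)
    (h1 : 0 ≤ L1) (h2 : 0 ≤ L2) (h3 : 0 ≤ L3) :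
    Continuous (fun p : Euc d × A × B => F p.1 p.2.1 p.2.2) := by
  refine (LipschitzWith.of_dist_le_mul (K := Real.toNNReal (L1 + L2 + L3)) ?_).continuous
  rintro ⟨x, a, b⟩ ⟨x', a', b'⟩
  rw [Real.coe_toNNReal _ (by positivity), dist_eq_norm]
  refine (hF x x' a a' a.2 a'.2 b b' b.2 b'.2).trans ?_
  rw [← dist_eq_norm, ← dist_eq_norm, ← dist_eq_norm, ← Subtype.dist_eq, ← Subtype.dist_eq]
  have hx : dist x x' ≤ dist (x, a, b) (x', a', b') := le_max_left _ _
  have ha : dist a a' ≤ dist (x, a, b) (x', a', b') :=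
    (le_max_left (dist a a') (dist b b')).trans (le_max_right _ _)
  have hb : dist b b' ≤ dist (x, a, b) (x', a', b') :=
    (le_max_right (dist a a') (dist b b')).trans (le_max_right _ _)
  rw [add_mul, add_mul]
  gcongr

lemma continuous_fbTraj {d nA nB : ℕ} {A : Set (Euc nA)} {B : Set (Euc nB)}
    {F : Euc d → Euc nA → Euc nB → Euc d}
    (hF : Continuous (fun p : Euc d × A × B => F p.1 p.2.1 p.2.2))
    {α : ℕ → Euc d × B → A} (hα : ∀ k, Continuous (α k))
    {b : ℕ → Euc d → B} (hb : ∀ k, Continuous (b k)) (k : ℕ) :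
    Continuous (fun x => fbTraj F x α b k) := by
  induction k with
  | zero => exact continuous_id
  | succ k ih =>
    exact hF.comp (ih.prodMk (((hα k).comp (ih.prodMk ((hb k).comp ih))).prodMk ((hb k).comp ih)))

lemma measurable_payoff {d : ℕ} {W : Type*} [MeasurableSpace W] {g φ : Euc d → ℝ}
    (hg : Continuous g) (hφ : Continuous φ) (N : ℕ) {xs : W → ℕ → Euc d}
    (hxs : ∀ k, Measurable (fun ω => xs ω k)) :
    Measurable (fun ω => payoff g φ N (xs ω)) :=
  (Measurable.iSup fun k : Fin N => hg.measurable.comp (hxs k)).sup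
    (hφ.measurable.comp (hxs N))

lemma abs_payoff_le {d : ℕ} {g φ : Euc d → ℝ} {N : ℕ} (hN : 0 < N) {xs : ℕ → Euc d} {R : ℝ}
    (hg : ∀ k ≤ N, |g (xs k)| ≤ R) (hφ : |φ (xs N)| ≤ R) : |payoff g φ N xs| ≤ R := by
  have : Nonempty (Fin N) := ⟨⟨0, hN⟩⟩
  rw [abs_le] at hφ ⊢
  exact ⟨hφ.1.trans le_sup_right,
    sup_le (ciSup_le fun k => (abs_le.1 (hg k k.2.le)).2) hφ.2⟩

lemma payoff_le_add {d : ℕ} {g φ : Euc d → ℝ} {N : ℕ} (hN : 0 < N) {xs ys : ℕ → Euc d} {R : ℝ}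
    (hg : ∀ k ≤ N, g (xs k) ≤ g (ys k) + R) (hφ : φ (xs N) ≤ φ (ys N) + R) :
    payoff g φ N xs ≤ payoff g φ N ys + R := by
  have : Nonempty (Fin N) := ⟨⟨0, hN⟩⟩
  refine sup_le (ciSup_le fun k => (hg k k.2.le).trans ?_) (hφ.trans ?_)
  · gcongr
    exact (le_ciSup (f := fun k : Fin N => g (ys k)) (Set.finite_range _).bddAbove k).trans
      le_sup_left
  · gcongr
    exact le_sup_right

lemma LipschitzWith.le_add_norm {d : ℕ} {g : Euc d → ℝ} {K : NNReal} (hg : LipschitzWith K g)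
    (x y : Euc d) : g x ≤ g y + K * ‖x - y‖ := by
  have h := hg.dist_le_mul x y
  rw [Real.dist_eq, dist_eq_norm] at h
  linarith [le_abs_self (g x - g y)]

/-- Open-loop trajectories from a bounded set are uniformly bounded at each time. -/
lemma exists_norm_oTraj_le {d nA nB : ℕ} {A : Set (Euc nA)} {B : Set (Euc nB)}
    (hA : IsCompact A) (hB : IsCompact B) {F : Euc d → Euc nA → Euc nB → Euc d}
    (hF : Continuous (fun p : Euc d × A × B => F p.1 p.2.1 p.2.2))
    {Ω₀ : Set (Euc d)} (hΩ : Bornology.IsBounded Ω₀) (k : ℕ) :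
    ∃ R, ∀ x ∈ Ω₀, ∀ (a : ℕ → A) (b : ℕ → B),
      ‖oTraj F x (fun j => (a j : Euc nA)) (fun j => (b j : Euc nB)) k‖ ≤ R := by
  induction k with
  | zero =>
    obtain ⟨R, hR⟩ := hΩ.exists_norm_le
    exact ⟨R, fun x hx _ _ => hR x hx⟩
  | succ k ih =>
    obtain ⟨R, hR⟩ := ih
    have := isCompact_iff_compactSpace.1 hA
    have := isCompact_iff_compactSpace.1 hB
    have hc : IsCompact (Metric.closedBall (0 : Euc d) R ×ˢ (univ : Set (A × B))) :=
      (isCompact_closedBall _ _).prod isCompact_univ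
    obtain ⟨R', hR'⟩ := hc.exists_bound_of_continuousOn hF.continuousOn
    refine ⟨R', fun x hx a b => hR' (_, a k, b k) ⟨?_, mem_univ _⟩⟩
    simpa using hR x hx a b

lemma isBounded_reachSet {d nA nB : ℕ} {A : Set (Euc nA)} {B : Set (Euc nB)}
    (hA : IsCompact A) (hB : IsCompact B) {f : Euc d → Euc nA → Euc nB → Euc d} {τ : ℝ}
    (hF : Continuous (fun p : Euc d × A × B => euler f τ p.1 p.2.1 p.2.2))
    {Ω₀ : Set (Euc d)} (hΩ : Bornology.IsBounded Ω₀) (N : ℕ) :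
    Bornology.IsBounded (reachSet A B f τ N Ω₀) := by
  choose R hR using exists_norm_oTraj_le hA hB hF hΩ
  obtain ⟨S, hS⟩ := ((Set.finite_Iic N).image R).bddAbove
  refine isBounded_iff_forall_norm_le.2 ⟨S, ?_⟩
  rintro z ⟨x, hx, k, hk, a, b, rfl⟩
  exact (hR k x hx a b).trans (hS ⟨k, hk, rfl⟩)

/-- Stability of feedback trajectories under perturbation of the feedback control along one of
the trajectories. -/
lemma norm_fbTraj_sub_le {d nA nB : ℕ} {A : Set (Euc nA)} {B : Set (Euc nB)}
    {F : Euc d → Euc nA → Euc nB → Euc d} {L1 L2 L3 : ℝ}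
    (h1 : 1 ≤ L1) (h2 : 0 ≤ L2) (h3 : 0 ≤ L3) (hF : LipOn A B F L1 L2 L3)
    {L M : ℝ} (hL : 0 ≤ L) (hM : 0 ≤ M) {α : ℕ → Euc d × B → A}
    (hα : ∀ k, LipschitzWith (Real.toNNReal L) (α k)) {b c : ℕ → Euc d → B}
    (hc : ∀ k, LipschitzWith (Real.toNNReal M) (c k)) {x : Euc d} {N : ℕ} {δ : ℝ} (hδ : 0 ≤ δ)
    (hbc : ∀ k ≤ N, ‖(b k (fbTraj F x α b k) : Euc nB) - c k (fbTraj F x α b k)‖ ≤ δ)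
    {k : ℕ} (hk : k ≤ N) :
    ‖fbTraj F x α b k - fbTraj F x α c k‖ ≤
      (L2 * L + L3) * k * (L1 + L2 * L * (1 + M) + L3 * M) ^ k * δ := by
  induction k with
  | zero => simp [fbTraj]
  | succ k ih =>
    have ih := ih (by omega)
    have hbk := hbc k (by omega)
    simp only [fbTraj]
    set y := fbTraj F x α b k
    set z := fbTraj F x α c k
    set P := L1 + L2 * L * (1 + M) + L3 * M with hP
    have hP1 : 1 ≤ P := by
      have : 0 ≤ L2 * L * (1 + M) + L3 * M := by positivity
      linarith
    set e := ‖y - z‖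
    have hβ : ‖(b k y : Euc nB) - c k z‖ ≤ δ + M * e := by
      have h := (hc k).dist_le_mul y z
      rw [Real.coe_toNNReal _ hM, Subtype.dist_eq, dist_eq_norm, dist_eq_norm] at h
      calc ‖(b k y : Euc nB) - c k z‖
          ≤ ‖(b k y : Euc nB) - c k y‖ + ‖(c k y : Euc nB) - c k z‖ :=
            norm_sub_le_norm_sub_add_norm_sub _ _ _
        _ ≤ δ + M * e := add_le_add hbk h
    have ha : ‖(α k (y, b k y) : Euc nA) - α k (z, c k z)‖
        ≤ L * (e + ‖(b k y : Euc nB) - c k z‖) := by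
      have h := (hα k).dist_le_mul (y, b k y) (z, c k z)
      rw [Real.coe_toNNReal _ hL, Subtype.dist_eq, dist_eq_norm] at h
      refine h.trans (mul_le_mul_of_nonneg_left ?_ hL)
      rw [Prod.dist_eq, Subtype.dist_eq, dist_eq_norm, dist_eq_norm]
      exact max_le_add_of_nonneg (norm_nonneg _) (norm_nonneg _)
    have hpow : 1 ≤ P ^ (k + 1) := one_le_pow₀ hP1
    calc ‖F y (α k (y, b k y)) (b k y) - F z (α k (z, c k z)) (c k z)‖
        ≤ L1 * e + L2 * ‖(α k (y, b k y) : Euc nA) - α k (z, c k z)‖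
            + L3 * ‖(b k y : Euc nB) - c k z‖ :=
          hF _ _ _ _ (Subtype.prop _) (Subtype.prop _) _ _ (Subtype.prop _) (Subtype.prop _)
      _ ≤ L1 * e + L2 * (L * (e + (δ + M * e))) + L3 * (δ + M * e) := by
          gcongr
          exact ha.trans (by gcongr)
      _ = P * e + (L2 * L + L3) * δ * 1 := by rw [hP]; ring
      _ ≤ P * ((L2 * L + L3) * k * P ^ k * δ) + (L2 * L + L3) * δ * P ^ (k + 1) := by
          gcongr
      _ = (L2 * L + L3) * ↑(k + 1) * P ^ (k + 1) * δ := by push_cast; ring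

/-- A uniform bound on the distance of two feedback controls along the trajectory bounds the payoff
difference. -/
lemma tJ0fb_le_add {d nA nB : ℕ} {A : Set (Euc nA)} {B : Set (Euc nB)}
    {F : Euc d → Euc nA → Euc nB → Euc d} {L1 L2 L3 : ℝ}
    (h1 : 1 ≤ L1) (h2 : 0 ≤ L2) (h3 : 0 ≤ L3) (hF : LipOn A B F L1 L2 L3)
    {L M : ℝ} (hL : 0 ≤ L) (hM : 0 ≤ M) {g φ : Euc d → ℝ} {Kg Kφ : NNReal}
    (hg : LipschitzWith Kg g) (hφ : LipschitzWith Kφ φ) {N : ℕ} (hN : 0 < N)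
    {α : Fin N → Euc d × B → A} (hα : ∀ k, LipschitzWith (Real.toNNReal L) (α k))
    {b c : Fin N → Euc d → B} (hc : ∀ k, LipschitzWith (Real.toNNReal M) (c k)) {x : Euc d}
    {δ : ℝ} (hδ : 0 ≤ δ)
    (hbc : ∀ i, ∀ k ≤ N, ‖(b i (fbTraj F x (extp hN α) (extp hN b) k) : Euc nB)
      - c i (fbTraj F x (extp hN α) (extp hN b) k)‖ ≤ δ) :
    tJ0fb F g φ hN x α b ≤ tJ0fb F g φ hN x α c +
      (Kg + Kφ) * ((L2 * L + L3) * N * (L1 + L2 * L * (1 + M) + L3 * M) ^ N) * δ := by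
  have hP1 : 1 ≤ L1 + L2 * L * (1 + M) + L3 * M := by
    have : 0 ≤ L2 * L * (1 + M) + L3 * M := by positivity
    linarith
  have key : ∀ k ≤ N, ‖fbTraj F x (extp hN α) (extp hN b) k
      - fbTraj F x (extp hN α) (extp hN c) k‖ ≤
      (L2 * L + L3) * N * (L1 + L2 * L * (1 + M) + L3 * M) ^ N * δ := by
    intro k hk
    refine (norm_fbTraj_sub_le h1 h2 h3 hF hL hM (fun _ => hα _) (fun _ => hc _) hδ
      (fun k hk => hbc _ k hk) hk).trans ?_
    gcongr
  have hnn := (norm_nonneg _).trans (key 0 (Nat.zero_le _))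
  have hKg : (0 : ℝ) ≤ Kg := Kg.2
  have hKφ : (0 : ℝ) ≤ Kφ := Kφ.2
  refine payoff_le_add hN (fun k hk => ?_) ?_
  · refine (hg.le_add_norm _ (fbTraj F x (extp hN α) (extp hN c) k)).trans ?_
    nlinarith [mul_le_mul_of_nonneg_left (key k hk) hKg, mul_nonneg hKφ hnn]
  · refine (hφ.le_add_norm _ (fbTraj F x (extp hN α) (extp hN c) N)).trans ?_
    nlinarith [mul_le_mul_of_nonneg_left (key N le_rfl) hKφ, mul_nonneg hKg hnn]

theorem global_scheme_lower_error_estimate {d nA nB : ℕ} (hnA : 1 ≤ nA) (hnB : 1 ≤ nB)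
    (A : Set (Euc nA)) (hAne : A.Nonempty) (hAc : IsCompact A)
    (B : Set (Euc nB)) (hBne : B.Nonempty) (hBc : IsCompact B)
    (f : Euc d → Euc nA → Euc nB → Euc d)
    (L1 L2 L3 : ℝ) (hL1 : 0 ≤ L1) (hL2 : 0 ≤ L2) (hL3 : 0 ≤ L3)
    (hf : ∀ x x' : Euc d, ∀ a a' : Euc nA, a ∈ A → a' ∈ A → ∀ b b' : Euc nB, b ∈ B → b' ∈ B →
      ‖f x a b - f x' a' b'‖ ≤ L1 * ‖x - x'‖ + L2 * ‖a - a'‖ + L3 * ‖b - b'‖)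
    (g φ : Euc d → ℝ) (Kg Kφ : NNReal) (hg : LipschitzWith Kg g) (hφ : LipschitzWith Kφ φ)
    (T : ℝ) (hT : 0 < T) (N : ℕ) (hN : 0 < N)
    {W : Type*} [MeasurableSpace W] (μ : Measure W) [IsProbabilityMeasure μ]
    (X : W → Euc d) (hX : Measurable X)
    (hXint : Integrable (fun ω => ‖X ω‖) μ)
    (Ω₀ : Set (Euc d)) (hΩ₀c : IsCompact Ω₀) (hXsupp : ∀ᵐ ω ∂μ, X ω ∈ Ω₀)
    -- approximation spaces
    (Ghat : Set (Euc d × B → A)) (hGhat : ∀ α ∈ Ghat, Measurable α)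
    (Bhat : Set (Euc d → B)) (hBhat : ∀ b ∈ Bhat, Measurable b)
    (L M : ℝ) (hL : 0 ≤ L) (hM : 0 ≤ M) :
    -- a constant depending only on `L`, `M` and the data
    ∃ C : ℝ, 0 ≤ C ∧
      ∀ (αhat : Fin N → Euc d × B → A) (bhat : Fin N → Euc d → B)
        (bstar : Fin N → Euc d → B) (η₂ ε₂ : ℝ), 0 ≤ η₂ → 0 ≤ ε₂ →
        -- `α̂ ∈ (Ĝ_L)^N`, `b̂ ∈ (ℬ̂_M)^N`
        (∀ k, αhat k ∈ Ghat ∧ LipschitzWith (Real.toNNReal L) (αhat k)) →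
        (∀ k, bhat k ∈ Bhat ∧ LipschitzWith (Real.toNNReal M) (bhat k)) →
        -- `η₂`-suboptimality of `b̂` against `α̂`
        ((∫ ω, tJ0fb (euler f (T / N)) g φ hN (X ω) αhat bhat ∂μ) ≥
          (⨆ b : Fin N → {bb : Euc d → B // bb ∈ Bhat},
            ∫ ω, tJ0fb (euler f (T / N)) g φ hN (X ω) αhat (fun k => (b k).1) ∂μ) - η₂) →
        -- `b* ∈ (ℬ_M)^N` is an `ε₂`-optimal Lipschitz feedback control for `α̂`
        (∀ k, Measurable (bstar k) ∧ LipschitzWith (Real.toNNReal M) (bstar k)) →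
        ((∫ ω, V0 A B (euler f (T / N)) g φ hN (X ω) ∂μ) ≤
          (∫ ω, tJ0fb (euler f (T / N)) g φ hN (X ω) αhat bstar ∂μ) + ε₂) →
        -- conclusion: lower weak error estimate for `V̂₀ = J̃₀(·, α̂[b̂], b̂)`
        (∫ ω, tJ0fb (euler f (T / N)) g φ hN (X ω) αhat bhat ∂μ) -
            (∫ ω, V0 A B (euler f (T / N)) g φ hN (X ω) ∂μ) ≥
          -(C * (⨆ k : Fin N,
              ⨅ b : {bb : Euc d → B // bb ∈ Bhat ∧ LipschitzWith (Real.toNNReal M) bb},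
                ⨆ z : reachSet A B f (T / N) N Ω₀,
                  ‖(bstar k (z : Euc d) : Euc nB) - (b.1 (z : Euc d) : Euc nB)‖)) -
            η₂ - ε₂ := by
  have hτ : 0 ≤ T / N := by positivity
  set τ := T / N
  have hFL : LipOn A B (euler f τ) (1 + τ * L1) (τ * L2) (τ * L3) := LipOn.euler hf hτ
  have hF1 : 1 ≤ 1 + τ * L1 := le_add_of_nonneg_right (by positivity)
  have hF2 : 0 ≤ τ * L2 := by positivity
  have hF3 : 0 ≤ τ * L3 := by positivity
  have hFc := hFL.continuous (zero_le_one.trans hF1) hF2 hF3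
  have hreach := isBounded_reachSet hAc hBc hFc hΩ₀c.isBounded N
  obtain ⟨Rg, hRg⟩ := (hg.isBounded_image hreach).exists_norm_le
  obtain ⟨Rφ, hRφ⟩ := (hφ.isBounded_image hreach).exists_norm_le
  have hJ : ∀ (α : Fin N → Euc d × B → A) (b : Fin N → Euc d → B),
      ∀ᵐ ω ∂μ, ‖tJ0fb (euler f τ) g φ hN (X ω) α b‖ ≤ max Rg Rφ := by
    intro α b
    filter_upwards [hXsupp] with ω hω
    refine abs_payoff_le hN (fun k hk => ?_) ?_
    · exact (hRg _ (mem_image_of_mem g (fbTraj_mem_reachSet f τ hω _ _ hk))).trans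
        (le_max_left _ _)
    · exact (hRφ _ (mem_image_of_mem φ (fbTraj_mem_reachSet f τ hω _ _ le_rfl))).trans
        (le_max_right _ _)
  have hint : ∀ (α : Fin N → Euc d × B → A) (b : Fin N → Euc d → B),
      (∀ k, Continuous (α k)) → (∀ k, Continuous (b k)) →
      Integrable (fun ω => tJ0fb (euler f τ) g φ hN (X ω) α b) μ := by
    intro α b hα hb
    refine Integrable.of_bound (Measurable.aestronglyMeasurable ?_) _ (hJ α b)
    exact measurable_payoff hg.continuous hφ.continuous N fun k =>
      (continuous_fbTraj hFc (fun _ => hα _) (fun _ => hb _) k).measurable.comp hX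
  obtain ⟨RB, hRB⟩ := hBc.isBounded.exists_norm_le
  set C := (Kg + Kφ : ℝ) * ((τ * L2 * L + τ * L3) * N *
    (1 + τ * L1 + τ * L2 * L * (1 + M) + τ * L3 * M) ^ N) with hC
  have hC0 : 0 ≤ C := by positivity
  refine ⟨C, hC0, ?_⟩
  intro αhat bhat bstar η₂ ε₂ _ _ hα hb hsub hbs hopt
  set D := ⨆ k : Fin N, ⨅ b : {bb : Euc d → B // bb ∈ Bhat ∧ LipschitzWith (Real.toNNReal M) bb},
    ⨆ z : reachSet A B f τ N Ω₀,
      ‖(bstar k (z : Euc d) : Euc nB) - (b.1 (z : Euc d) : Euc nB)‖ with hD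
  have : Nonempty {bb : Euc d → B // bb ∈ Bhat ∧ LipschitzWith (Real.toNNReal M) bb} :=
    ⟨⟨bhat ⟨0, hN⟩, hb _⟩⟩
  have hbdd : ∀ b b' : Euc d → B, BddAbove (range fun z : reachSet A B f τ N Ω₀ =>
      ‖(b (z : Euc d) : Euc nB) - (b' (z : Euc d) : Euc nB)‖) := by
    intro b b'
    refine ⟨RB + RB, ?_⟩
    rintro _ ⟨z, rfl⟩
    exact (norm_sub_le _ _).trans (add_le_add (hRB _ (b z).2) (hRB _ (b' z).2))
  have hDnn : 0 ≤ D :=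
    Real.iSup_nonneg fun k => Real.iInf_nonneg fun b => Real.iSup_nonneg fun z => norm_nonneg _
  have main : ∀ δ > 0, (∫ ω, tJ0fb (euler f τ) g φ hN (X ω) αhat bstar ∂μ) ≤
      (∫ ω, tJ0fb (euler f τ) g φ hN (X ω) αhat bhat ∂μ) + η₂ + C * (D + δ) := by
    intro δ hδ
    have hex : ∀ k, ∃ b : {bb : Euc d → B // bb ∈ Bhat ∧ LipschitzWith (Real.toNNReal M) bb},
        ∀ z ∈ reachSet A B f τ N Ω₀,
          ‖(bstar k z : Euc nB) - (b.1 z : Euc nB)‖ ≤ D + δ := by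
      intro k
      obtain ⟨b, hbk⟩ := exists_lt_of_ciInf_lt (lt_of_le_of_lt
        (le_ciSup (f := fun k : Fin N =>
          ⨅ b : {bb : Euc d → B // bb ∈ Bhat ∧ LipschitzWith (Real.toNNReal M) bb},
            ⨆ z : reachSet A B f τ N Ω₀,
              ‖(bstar k (z : Euc d) : Euc nB) - (b.1 (z : Euc d) : Euc nB)‖)
          (Set.finite_range _).bddAbove k) (lt_add_of_pos_right D hδ))
      exact ⟨b, fun z hz => (le_ciSup (hbdd (bstar k) b.1) ⟨z, hz⟩).trans hbk.le⟩
    choose c hc using hex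
    have hcmp : (∫ ω, tJ0fb (euler f τ) g φ hN (X ω) αhat bstar ∂μ) ≤
        (∫ ω, tJ0fb (euler f τ) g φ hN (X ω) αhat (fun k => (c k).1) ∂μ) + C * (D + δ) := by
      have hi1 := hint αhat bstar (fun k => (hα k).2.continuous) (fun k => (hbs k).2.continuous)
      have hi2 := hint αhat (fun k => (c k).1) (fun k => (hα k).2.continuous)
        (fun k => (c k).2.2.continuous)
      have h := integral_mono_ae hi1 (hi2.add (integrable_const (C * (D + δ)))) <| by
        filter_upwards [hXsupp] with ω hω
        exact tJ0fb_le_add hF1 hF2 hF3 hFL hL hM hg hφ hN (fun k => (hα k).2)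
          (fun k => (c k).2.2) (by positivity)
          (fun i k hk => hc i _ (fbTraj_mem_reachSet f τ hω _ _ hk))
      simp only [Pi.add_apply] at h
      rwa [integral_add hi2 (integrable_const _), integral_const, probReal_univ, one_smul] at h
    have hsup : (∫ ω, tJ0fb (euler f τ) g φ hN (X ω) αhat (fun k => (c k).1) ∂μ) ≤
        ⨆ b : Fin N → {bb : Euc d → B // bb ∈ Bhat},
          ∫ ω, tJ0fb (euler f τ) g φ hN (X ω) αhat (fun k => (b k).1) ∂μ := by
      refine le_ciSup (f := fun b : Fin N → {bb : Euc d → B // bb ∈ Bhat} =>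
        ∫ ω, tJ0fb (euler f τ) g φ hN (X ω) αhat (fun k => (b k).1) ∂μ) ⟨max Rg Rφ, ?_⟩
        (fun k => ⟨(c k).1, (c k).2.1⟩)
      rintro _ ⟨b, rfl⟩
      refine (le_abs_self _).trans ((norm_integral_le_of_norm_le_const (hJ αhat _)).trans ?_)
      simp
    linarith
  have hlim : (∫ ω, tJ0fb (euler f τ) g φ hN (X ω) αhat bstar ∂μ) ≤
      (∫ ω, tJ0fb (euler f τ) g φ hN (X ω) αhat bhat ∂μ) + η₂ + C * D := by
    refine le_of_forall_pos_le_add fun ε hε => (main (ε / (C + 1)) (by positivity)).trans ?_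
    have : C * (ε / (C + 1)) ≤ ε := by
      rw [mul_div_assoc', div_le_iff₀ (by positivity)]
      nlinarith
    linarith [mul_add C D (ε / (C + 1))]
  linarith

end
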